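/- For every positive integer n, defining s(i) = f((i−1)/n + 1/(8n)) for i ∈ {1, …, n}, it holds for every integer j with 0 ≤ j ≤ n that (1/n)·∑_{i=1}^{j} s(i) ≤ F(j/n). -/

import Mathlib

open Real

noncomputable def R : ℝ := 1 / (1 + Real.log 2)

noncomputable def f (x : ℝ) : ℝ :=
  if x ≤ R then 1/2 else (2 * Real.exp 1) ^ (x - 1)

noncomputable def F (x : ℝ) : ℝ :=
  if x ≤ R then x/2 else R * (2 * Real.exp 1) ^ (x - 1)

noncomputable def P (c : ℝ) : ℝ := ∫ y in (0:ℝ)..1, min (f y) c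

noncomputable def Q (c : ℝ) : ℝ := ∫ y in (0:ℝ)..1, max (c - f y) 0

noncomputable def xic : ℝ := (1 + (2/3) * Real.log (4/3)) * R - 2/3

noncomputable def phi : ℝ := (2/3) * xic / (2/3 - R + xic)

noncomputable def xi (x : ℝ) : ℝ :=
  if x ≤ 1/3 then xic / x else 9 * xic * (1 - 2 * x)

noncomputable def T (a b : ℝ) : ℝ := (a + b - 1/2) * (xi b - xi a)

noncomputable def pile (x : ℝ) : ℝ := max (2/3) (2 * x)

theorem R_pos : 0 < R := by
  have : 0 < Real.log 2 := Real.log_pos (by norm_num)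
  unfold R
  positivity

theorem two_mul_exp_one_rpow (y : ℝ) : (2 * Real.exp 1) ^ y = Real.exp (y / R) := by
  rw [Real.rpow_def_of_pos (by positivity), Real.log_mul (by norm_num) (Real.exp_ne_zero 1),
    Real.log_exp, R]
  congr 1
  rw [div_div_eq_mul_div, div_one]
  ring

theorem half_le_R_mul_rpow (x : ℝ) : x / 2 ≤ R * (2 * Real.exp 1) ^ (x - 1) := by
  have hR := R_pos
  have hlog : 1 / R = 1 + Real.log 2 := by simp [R]
  have hexp : Real.exp ((x - 1) / R) = Real.exp (x / R - 1) / 2 := by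
    rw [sub_div, hlog, show x / R - (1 + Real.log 2) = (x / R - 1) - Real.log 2 by ring,
      Real.exp_sub, Real.exp_log (by norm_num)]
  have h := Real.add_one_le_exp (x / R - 1)
  have hx : x = R * (x / R) := by field_simp
  rw [two_mul_exp_one_rpow, hexp]
  nlinarith [mul_le_mul_of_nonneg_left h hR.le]

theorem F_le_R_mul_rpow (x : ℝ) : F x ≤ R * (2 * Real.exp 1) ^ (x - 1) := by
  unfold F
  split_ifs
  · exact half_le_R_mul_rpow x
  · exact le_rfl

theorem half_le_F (x : ℝ) : x / 2 ≤ F x := by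
  unfold F
  split_ifs
  · exact le_rfl
  · exact half_le_R_mul_rpow x

theorem mul_exp_div_eight_le {t : ℝ} (ht : 0 ≤ t) : t * Real.exp (t / 8) ≤ Real.exp t - 1 := by
  have h₁ : t / 2 ≤ Real.sinh (t / 2) := Real.self_le_sinh_iff.2 (by positivity)
  rw [Real.sinh_eq] at h₁
  have h₂ : Real.exp (t / 8) ≤ Real.exp (t / 2) := Real.exp_le_exp.2 (by linarith)
  have h₃ : Real.exp t = Real.exp (t / 2) * Real.exp (t / 2) := by
    rw [← Real.exp_add, add_halves]
  have h₄ : Real.exp (t / 2) * Real.exp (-(t / 2)) = 1 := by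
    rw [← Real.exp_add, add_neg_cancel, Real.exp_zero]
  nlinarith [mul_le_mul_of_nonneg_left h₂ ht,
    mul_le_mul_of_nonneg_left h₁ (Real.exp_pos (t / 2)).le]

/-- Sampling `f` one eighth of the way into an interval underestimates the increment of `F`. -/
theorem F_add_mul_f_le (a : ℝ) {h : ℝ} (hh : 0 ≤ h) : F a + h * f (a + h / 8) ≤ F (a + h) := by
  have hR := R_pos
  by_cases hm : a + h / 8 ≤ R
  · have hF := half_le_F (a + h)
    have ha : F a = a / 2 := if_pos (by linarith)
    have hf : f (a + h / 8) = 1 / 2 := if_pos hm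
    rw [ha, hf]
    linarith
  · have ha := F_le_R_mul_rpow a
    have hb : F (a + h) = R * (2 * Real.exp 1) ^ (a + h - 1) := if_neg (by linarith)
    have hf : f (a + h / 8) = (2 * Real.exp 1) ^ (a + h / 8 - 1) := if_neg hm
    rw [two_mul_exp_one_rpow] at ha hb hf
    have e₁ : Real.exp ((a + h - 1) / R) = Real.exp ((a - 1) / R) * Real.exp (h / R) := by
      rw [← Real.exp_add]
      ring_nf
    have e₂ : Real.exp ((a + h / 8 - 1) / R) =
        Real.exp ((a - 1) / R) * Real.exp (h / R / 8) := by
      rw [← Real.exp_add]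
      ring_nf
    have key := mul_le_mul_of_nonneg_left (mul_exp_div_eight_le (div_nonneg hh hR.le))
      (mul_pos hR (Real.exp_pos ((a - 1) / R))).le
    have hx : h = R * (h / R) := by field_simp
    rw [hb, hf, e₁, e₂]
    calc _ ≤ R * Real.exp ((a - 1) / R) + R * (h / R) *
          (Real.exp ((a - 1) / R) * Real.exp (h / R / 8)) := by
          rw [← hx]
          gcongr
      _ ≤ _ := by linarith

theorem stmt_18 : ∀ n : ℕ, 0 < n → ∀ j : ℕ, j ≤ n →
    (1 / n) * ∑ i ∈ Finset.Icc 1 j, f (((i : ℝ) - 1) / n + 1 / (8 * n)) ≤ F (j / n) := by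
  intro n hn j _
  have hn' : (0 : ℝ) < n := Nat.cast_pos.2 hn
  clear * - hn'
  induction j with
  | zero => simpa using half_le_F 0
  | succ k ih =>
    have step := F_add_mul_f_le ((k : ℝ) / n) (h := 1 / n) (by positivity)
    rw [Finset.sum_Icc_succ_top (by omega), mul_add]
    have e₁ : (((k + 1 : ℕ) : ℝ) - 1) / n + 1 / (8 * n) = (k : ℝ) / n + 1 / n / 8 := by
      push_cast
      field_simp
      ring
    have e₂ : ((k + 1 : ℕ) : ℝ) / n = (k : ℝ) / n + 1 / n := by
      push_cast
      ring
    rw [e₁, e₂]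
    linarith
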